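/- Let V and Q be finite-dimensional real normed vector spaces, let a : V × V → ℝ be a bilinear form with a(v, v) ≥ c_0 ‖v‖²_V and |a(u, v)| ≤ C_a ‖u‖_V ‖v‖_V for all u, v ∈ V, let J : Q × Q → ℝ be a symmetric positive semidefinite bilinear form, and let b : V × Q → ℝ be bilinear and satisfy c_b ‖q‖_Q ≤ sup_{v ∈ V, v ≠ 0} b(v, q)/‖v‖_V + J(q, q)^{1/2} for all q ∈ Q, with constants c_0, C_a, c_b > 0. Define A(u, p; v, q) = a(u, v) + b(v, p) + b(u, q) − J(p, q) and the product norm ‖(v, q)‖² = ‖v‖²_V + ‖q‖²_Q + J(q, q). Then there exists C_s > 0, depending only on c_0, C_a, and c_b, such that C_s ‖(u, p)‖ ≤ sup_{(v,q) ≠ (0,0)} A(u, p; v, q)/‖(v, q)‖ for all (u, p) ∈ V × Q. -/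

import Mathlib

noncomputable section

/-- A linear form on a finite-dimensional space is controlled by its supremum relative to any
gauge that dominates the norm. -/
theorem LinearMap.le_sSup_div_mul {E : Type*} [NormedAddCommGroup E] [NormedSpace ℝ E]
    [FiniteDimensional ℝ E] (f : E →ₗ[ℝ] ℝ) (N : E → ℝ) (hN : ∀ x, ‖x‖ ≤ N x) {x : E}
    (hx : x ≠ 0) : f x ≤ sSup ((fun y => f y / N y) '' {y | y ≠ 0}) * N x := by
  have hpos : ∀ y : E, y ≠ 0 → 0 < N y := fun y hy => (norm_pos_iff.mpr hy).trans_le (hN y)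
  rw [← div_le_iff₀ (hpos x hx)]
  refine le_csSup ⟨‖f.toContinuousLinearMap‖, ?_⟩ ⟨x, hx, rfl⟩
  rintro _ ⟨y, hy, rfl⟩
  rw [div_le_iff₀ (hpos y hy)]
  calc f y ≤ ‖f.toContinuousLinearMap y‖ := le_abs_self _
    _ ≤ ‖f.toContinuousLinearMap‖ * ‖y‖ := f.toContinuousLinearMap.le_opNorm y
    _ ≤ ‖f.toContinuousLinearMap‖ * N y := by gcongr; exact hN y

/-- The product norm on `V × Q` is dominated by its augmentation with a nonnegative term. -/
theorem Prod.norm_le_sqrt_sq_add_sq_add {V Q : Type*} [NormedAddCommGroup V]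
    [NormedAddCommGroup Q] (x : V × Q) {j : ℝ} (hj : 0 ≤ j) :
    ‖x‖ ≤ Real.sqrt (‖x.1‖ ^ 2 + ‖x.2‖ ^ 2 + j) := by
  refine max_le (Real.le_sqrt_of_sq_le ?_) (Real.le_sqrt_of_sq_le ?_) <;>
    nlinarith [sq_nonneg ‖x.1‖, sq_nonneg ‖x.2‖]

/-- The real-number inequality behind the saddle-point estimate: `x`, `y`, `j` stand for
`‖u‖`, `‖p‖`, `√J(p, p)`, and `N`, `S` for the norm of `(u, p)` and the supremum. -/
theorem saddle_point_norm_le {c₀ C c : ℝ} (hc₀ : 0 < c₀) (hc : 0 < c)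
    {x y j N S : ℝ} (hy : 0 ≤ y) (hS : 0 ≤ S)
    (hN : N ^ 2 = x ^ 2 + y ^ 2 + j ^ 2) (hcoer : c₀ * x ^ 2 + j ^ 2 ≤ S * N)
    (hinf : c * y ≤ S + C * x + j) :
    N ≤ ((1 + 3 * C ^ 2 / c ^ 2) / c₀ + 1 + 6 / c ^ 2 + 1) * S := by
  set D := 3 / c ^ 2 with hD
  set A := (1 + 3 * C ^ 2 / c ^ 2) / c₀ with hA
  have hD0 : 0 < D := by positivity
  have hA0 : 0 < A := by positivity
  have hAc : A * c₀ = 1 + D * C ^ 2 := by rw [hA, hD]; field_simp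
  have h6 : 6 / c ^ 2 = 2 * D := by rw [hD]; ring
  have hysq : y ^ 2 ≤ D * (S ^ 2 + C ^ 2 * x ^ 2 + j ^ 2) := by
    have hsq : (c * y) ^ 2 ≤ (S + C * x + j) ^ 2 := pow_le_pow_left₀ (by positivity) hinf 2
    rw [hD, div_mul_eq_mul_div, le_div_iff₀ (by positivity)]
    nlinarith [sq_nonneg (S - C * x), sq_nonneg (S - j), sq_nonneg (C * x - j)]
  have hK : N ^ 2 ≤ D * S ^ 2 + (A + 1 + D) * (S * N) := by
    have hmul := mul_le_mul_of_nonneg_left hcoer (by positivity : 0 ≤ A + 1 + D)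
    have hAx : A * c₀ * x ^ 2 = (1 + D * C ^ 2) * x ^ 2 := by rw [hAc]
    have h1 : 0 ≤ (1 + D) * c₀ * x ^ 2 := by positivity
    have h2 : 0 ≤ A * j ^ 2 := by positivity
    nlinarith
  rw [h6]
  by_contra! hlt
  have hNS : 0 < N := lt_of_le_of_lt (by positivity) hlt
  have hSN : S ≤ N := by nlinarith [mul_nonneg (by positivity : 0 ≤ A + 1 + 2 * D) hS]
  have h3 : D * S ^ 2 ≤ D * (S * N) := by
    gcongr; nlinarith
  have h4 : 0 ≤ S * N := by positivity
  nlinarith [mul_lt_mul_of_pos_right hlt hNS]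

/-- **Abstract saddle-point stability.**
Let `V` and `Q` be finite-dimensional real normed vector spaces, `a : V × V → ℝ` a bilinear
form with `a(v, v) ≥ c₀ ‖v‖²` and `|a(u, v)| ≤ C_a ‖u‖ ‖v‖`, `J : Q × Q → ℝ` a symmetric
positive semidefinite bilinear form, and `b : V × Q → ℝ` bilinear with
`c_b ‖q‖ ≤ sup_{v ≠ 0} b(v, q)/‖v‖ + J(q, q)^{1/2}` for all `q`.  Define
`A(u, p; v, q) = a(u, v) + b(v, p) + b(u, q) − J(p, q)` and
`‖(v, q)‖² = ‖v‖² + ‖q‖² + J(q, q)`.  Then there exists `C_s > 0`, depending only on `c₀`,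
`C_a` and `c_b`, such that
`C_s ‖(u, p)‖ ≤ sup_{(v,q) ≠ 0} A(u, p; v, q)/‖(v, q)‖` for all `(u, p)`. -/
theorem abstract_saddle_point_stability (c₀ C_a c_b : ℝ)
    (hc₀ : 0 < c₀) (hCa : 0 < C_a) (hcb : 0 < c_b) :
    ∃ C_s > (0 : ℝ),
      ∀ (V Q : Type) [NormedAddCommGroup V] [NormedSpace ℝ V] [FiniteDimensional ℝ V]
        [NormedAddCommGroup Q] [NormedSpace ℝ Q] [FiniteDimensional ℝ Q]
        (a : V →ₗ[ℝ] V →ₗ[ℝ] ℝ) (b : V →ₗ[ℝ] Q →ₗ[ℝ] ℝ) (J : Q →ₗ[ℝ] Q →ₗ[ℝ] ℝ),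
        (∀ v : V, c₀ * ‖v‖ ^ 2 ≤ a v v) →
        (∀ u v : V, |a u v| ≤ C_a * ‖u‖ * ‖v‖) →
        (∀ p q : Q, J p q = J q p) →
        (∀ q : Q, 0 ≤ J q q) →
        (∀ q : Q, c_b * ‖q‖ ≤
          sSup ((fun v : V => b v q / ‖v‖) '' {v : V | v ≠ 0}) + Real.sqrt (J q q)) →
        ∀ (u : V) (p : Q),
          C_s * Real.sqrt (‖u‖ ^ 2 + ‖p‖ ^ 2 + J p p) ≤
            sSup ((fun vq : V × Q =>
                (a u vq.1 + b vq.1 p + b u vq.2 - J p vq.2) /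
                  Real.sqrt (‖vq.1‖ ^ 2 + ‖vq.2‖ ^ 2 + J vq.2 vq.2)) ''
              {vq : V × Q | vq ≠ 0}) := by
  refine ⟨((1 + 3 * C_a ^ 2 / c_b ^ 2) / c₀ + 1 + 6 / c_b ^ 2 + 1)⁻¹, by positivity, ?_⟩
  intro V Q _ _ _ _ _ _ a b J hcoer hcont _ hJ hinf u p
  by_cases hup : (u, p) = 0
  · obtain ⟨rfl, rfl⟩ := Prod.mk_eq_zero.mp hup
    refine le_of_eq_of_le (by simp) (Real.sSup_nonneg ?_)
    rintro _ ⟨x, -, rfl⟩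
    simp
  set S := sSup ((fun vq : V × Q => (a u vq.1 + b vq.1 p + b u vq.2 - J p vq.2) /
    Real.sqrt (‖vq.1‖ ^ 2 + ‖vq.2‖ ^ 2 + J vq.2 vq.2)) '' {vq : V × Q | vq ≠ 0}) with hSdef
  have htest : ∀ (v : V) (q : Q), (v, q) ≠ 0 →
      a u v + b v p + b u q - J p q ≤ S * Real.sqrt (‖v‖ ^ 2 + ‖q‖ ^ 2 + J q q) :=
    fun v q hvq => LinearMap.le_sSup_div_mul
      ((a u + b.flip p).comp (LinearMap.fst ℝ V Q) + (b u).comp (LinearMap.snd ℝ V Q)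
        - (J p).comp (LinearMap.snd ℝ V Q))
      (fun x => Real.sqrt (‖x.1‖ ^ 2 + ‖x.2‖ ^ 2 + J x.2 x.2))
      (fun x => Prod.norm_le_sqrt_sq_add_sq_add x (hJ x.2)) hvq
  set N := Real.sqrt (‖u‖ ^ 2 + ‖p‖ ^ 2 + J p p) with hNdef
  have hN0 : 0 < N :=
    (norm_pos_iff.mpr hup).trans_le (Prod.norm_le_sqrt_sq_add_sq_add (u, p) (hJ p))
  have hdiag : c₀ * ‖u‖ ^ 2 + J p p ≤ S * N := by
    have h := htest u (-p) (by simpa using hup)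
    simp only [map_neg, LinearMap.neg_apply, norm_neg, neg_neg] at h
    rw [← hNdef] at h
    linarith [hcoer u]
  have hS0 : 0 ≤ S := by
    refine nonneg_of_mul_nonneg_left (le_trans ?_ hdiag) hN0
    have := hJ p
    positivity
  have hsup : sSup ((fun v : V => b v p / ‖v‖) '' {v : V | v ≠ 0}) ≤ S + C_a * ‖u‖ := by
    refine Real.sSup_le ?_ (by positivity)
    rintro _ ⟨v, hv, rfl⟩
    have hv : v ≠ 0 := hv
    rw [div_le_iff₀ (norm_pos_iff.mpr hv)]
    have h := htest v 0 (by simp [hv])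
    simp only [map_zero, norm_zero, add_zero, sub_zero, ne_eq, OfNat.ofNat_ne_zero,
      not_false_eq_true, zero_pow, Real.sqrt_sq (norm_nonneg v)] at h
    linarith [neg_abs_le (a u v), hcont u v]
  rw [inv_mul_le_iff₀ (by positivity)]
  have hJsq : Real.sqrt (J p p) ^ 2 = J p p := Real.sq_sqrt (hJ p)
  refine saddle_point_norm_le (j := Real.sqrt (J p p)) hc₀ hcb (norm_nonneg p) hS0 ?_ ?_
    ((hinf p).trans (by gcongr))
  · rw [hJsq, hNdef, Real.sq_sqrt (by have := hJ p; positivity)]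
  · rwa [hJsq]
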